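/- Let B ⊂ ℝ³ be a convex body whose support function H (extended to ℝ³ positively homogeneously of degree 1) is three times continuously differentiable on ℝ³ ∖ {0}, and suppose B is positioned with its centroid at the origin, i.e. for every unit vector Ω' and every pair of orthonormal vectors e₁', e₂' orthogonal to Ω', ∫_0^{2π} ⟨∇H(cos τ·e₁' + sin τ·e₂'), Ω'⟩ dτ = 0. Fix a unit vector Ω and orthonormal vectors e₁, e₂ orthogonal to Ω, and set u(τ) = cos τ·e₁ + sin τ·e₂, E(τ) = −sin τ·e₁ + cos τ·e₂, N(ν,τ) = −sin ν·u(τ) + cos ν·Ω, and R(ν,τ,φ) = f_{ν,τ}(φ) + f_{ν,τ}''(φ), where f_{ν,τ}(φ) = H(cos φ·E(τ) + sin φ·N(ν,τ)). Then H(Ω) = (1/(4π))·∫_0^{2π} ∫_0^{π/2} R(0,τ,φ)·cos φ dφ dτ + (1/(8π²))·∫_0^{2π} ∫_{−π/2}^{π/2} R(0,τ,φ)·((π + 2φ)·cos φ − 2·sin³φ) dφ dτ − (1/(2π²))·∫_0^{π/2} (sin ν / cos²ν)·( ∫_0^{2π} ∫_0^{2π} R(ν,τ,φ)·sin³φ dφ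 dτ ) dν. -/

import Mathlib

open Real
open scoped RealInnerProductSpace
open Set Filter Topology MeasureTheory

lemma param_deriv (U : Set ℝ) (hU : IsOpen U) (K K' : ℝ → ℝ → ℝ)
    (hder : ∀ s ∈ U, ∀ t, HasDerivAt (fun s => K s t) (K' s t) s)
    (hK : ContinuousOn (Function.uncurry K) (U ×ˢ univ))
    (hK' : ContinuousOn (Function.uncurry K') (U ×ˢ univ)) (a b s : ℝ) (hs : s ∈ U) :
    HasDerivAt (fun s => ∫ t in a..b, K s t) (∫ t in a..b, K' s t) s := by
  obtain ⟨ε, hε, hball⟩ := Metric.nhds_basis_closedBall.mem_iff.1 (hU.mem_nhds hs)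
  have hcomp : IsCompact (Metric.closedBall s ε ×ˢ uIcc a b) :=
    (isCompact_closedBall s ε).prod isCompact_uIcc
  obtain ⟨C, hC⟩ := hcomp.exists_bound_of_continuousOn
    (hK'.mono (prod_mono hball (subset_univ _)))
  have sl : ∀ (L : ℝ → ℝ → ℝ), ContinuousOn (Function.uncurry L) (U ×ˢ univ) → ∀ x ∈ U,
      Continuous (L x) := by
    intro L hL x hx
    rw [← continuousOn_univ]
    exact hL.comp (f := fun t => (x, t)) (by fun_prop) (fun t _ => ⟨hx, trivial⟩)
  refine (intervalIntegral.hasDerivAt_integral_of_dominated_loc_of_deriv_le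
    (F := K) (F' := K') (bound := fun _ => C)
    (Metric.closedBall_mem_nhds s hε) ?_ ?_ ?_ ?_ ?_ ?_).2
  · filter_upwards [hU.mem_nhds hs] with x hx
    exact (sl K hK x hx).aestronglyMeasurable
  · exact (sl K hK s hs).intervalIntegrable _ _
  · exact (sl K' hK' s hs).aestronglyMeasurable
  · refine Eventually.of_forall fun t ht x hx => hC (x, t) ⟨hx, uIoc_subset_uIcc ht⟩
  · exact intervalIntegrable_const
  · exact Eventually.of_forall fun t _ x hx => hder x (hball hx) t

lemma param_deriv_contDiff (n : ℕ) (U : Set ℝ) (hU : IsOpen U) (K : ℝ × ℝ → ℝ)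
    (hK : ContDiffOn ℝ (n + 1) K (U ×ˢ univ)) (a b : ℝ) :
    ContDiffOn ℝ n (fun p => fderiv ℝ K p (1, 0)) (U ×ˢ univ) ∧
    (∀ s ∈ U, ∀ t, HasDerivAt (fun s => K (s, t)) (fderiv ℝ K (s, t) (1, 0)) s) ∧
    ∀ s ∈ U, HasDerivAt (fun s => ∫ t in a..b, K (s, t))
      (∫ t in a..b, fderiv ℝ K (s, t) (1, 0)) s := by
  have hO : IsOpen (U ×ˢ (univ : Set ℝ)) := hU.prod isOpen_univ
  have h1 : ContDiffOn ℝ n (fun p => fderiv ℝ K p (1, 0)) (U ×ˢ univ) :=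
    (hK.fderiv_of_isOpen hO le_rfl).clm_apply contDiffOn_const
  have h2 : ∀ s ∈ U, ∀ t, HasDerivAt (fun s => K (s, t)) (fderiv ℝ K (s, t) (1, 0)) s := by
    intro s hs t
    have hd : DifferentiableAt ℝ K (s, t) :=
      (hK.differentiableOn (by simp)).differentiableAt (hO.mem_nhds ⟨hs, trivial⟩)
    exact hd.hasFDerivAt.comp_hasDerivAt (f := fun s => (s, t)) s
      ((hasDerivAt_id s).prodMk (hasDerivAt_const s t))
  refine ⟨h1, h2, fun s hs => ?_⟩
  exact param_deriv U hU (fun s t => K (s, t)) (fun s t => fderiv ℝ K (s, t) (1, 0)) h2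
    hK.continuousOn h1.continuousOn a b s hs

lemma parts2 (f w w' w'' : ℝ → ℝ) (hf : ContDiff ℝ 2 f)
    (hw : ∀ x, HasDerivAt w (w' x) x) (hw' : ∀ x, HasDerivAt w' (w'' x) x)
    (hc : Continuous w'') (a b : ℝ) :
    ∫ x in a..b, (f x + deriv (deriv f) x) * w x =
      (deriv f b * w b - f b * w' b) - (deriv f a * w a - f a * w' a)
      + ∫ x in a..b, f x * (w x + w'' x) := by
  have hf1 : ContDiff ℝ 1 (deriv f) := by
    have : ContDiff ℝ (1 + 1) f := by simpa [one_add_one_eq_two] using hf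
    exact (contDiff_succ_iff_deriv.1 this).2.2
  have c0 : Continuous f := hf.continuous
  have c1 : Continuous (deriv f) := hf1.continuous
  have c2 : Continuous (deriv (deriv f)) := hf1.continuous_deriv le_rfl
  have cw : Continuous w := continuous_iff_continuousAt.2 fun x => (hw x).continuousAt
  have hd0 : ∀ x, HasDerivAt f (deriv f x) x := fun x =>
    (hf.differentiable (by simp) x).hasDerivAt
  have hd1 : ∀ x, HasDerivAt (deriv f) (deriv (deriv f) x) x := fun x =>
    (hf1.differentiable (by simp) x).hasDerivAt
  have key := intervalIntegral.integral_eq_sub_of_hasDerivAt (a := a) (b := b)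
    (f := fun x => deriv f x * w x - f x * w' x)
    (f' := fun x => deriv (deriv f) x * w x - f x * w'' x)
    (fun x _ => by
      refine (((hd1 x).fun_mul (hw x)).fun_sub ((hd0 x).fun_mul (hw' x))).congr_deriv ?_
      ring) (by apply Continuous.intervalIntegrable; fun_prop)
  rw [← key, ← intervalIntegral.integral_add]
  · congr 1; ext x; ring
  · apply Continuous.intervalIntegrable; fun_prop
  · apply Continuous.intervalIntegrable; fun_prop

lemma swapc (F : ℝ → ℝ → ℝ) (hF : Continuous (Function.uncurry F)) (a b c d : ℝ) :
    ∫ x in a..b, ∫ y in c..d, F x y = ∫ y in c..d, ∫ x in a..b, F x y := by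
  apply intervalIntegral_intervalIntegral_swap
  exact (hF.continuousOn.integrableOn_compact (isCompact_uIcc.prod isCompact_uIcc)).mono_set
    (prod_mono uIoc_subset_uIcc uIoc_subset_uIcc)

/-- one-dimensional core -/
lemma core (A A' : ℝ → ℝ) (hA : Continuous A)
    (hd : ∀ s ∈ Ioo (-1:ℝ) 1, HasDerivAt A (A' s) s)
    (hA' : ContinuousOn A' (Ioo (-1:ℝ) 1))
    (hq : ∃ C, ∃ δ > 0, ∀ s, |s| ≤ δ → |A s - A 0| ≤ C * s ^ 2) :
    ∫ ν in (0:ℝ)..(π / 2), sin ν / cos ν ^ 2 *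
      (∫ φ in (0:ℝ)..(2 * π), A (cos ν * sin φ) * sin (3 * φ))
     = - ∫ φ in (0:ℝ)..(2 * π), A (sin φ) * (sin φ * cos φ ^ 2) := by
  obtain ⟨C, δ, hδ, hq⟩ := hq
  have hC : 0 ≤ C := by
    have := (abs_nonneg _).trans (hq δ (abs_of_pos hδ).le)
    by_contra h
    nlinarith [sq_pos_of_pos hδ]
  set g : ℝ → ℝ := fun c => ∫ φ in (0:ℝ)..(2 * π), A (c * sin φ) * sin (3 * φ) with hg
  set m : ℝ → ℝ := fun c => ∫ φ in (0:ℝ)..(2 * π), A (c * sin φ) * (sin φ * cos φ ^ 2) with hm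
  have gcont : Continuous g := by
    apply intervalIntegral.continuous_parametric_intervalIntegral_of_continuous'
    fun_prop
  have mcont : Continuous m := by
    apply intervalIntegral.continuous_parametric_intervalIntegral_of_continuous'
    fun_prop
  -- quadratic bounds for kernels of mean zero
  have bd : ∀ k : ℝ → ℝ, Continuous k → (∀ x, |k x| ≤ 1) → (∫ φ in (0:ℝ)..(2 * π), k φ) = 0 →
      ∀ c, |c| ≤ δ → |∫ φ in (0:ℝ)..(2 * π), A (c * sin φ) * k φ| ≤ C * c ^ 2 * (2 * π) := by
    intro k hk hk1 hk0 c hc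
    have e : ∫ φ in (0:ℝ)..(2 * π), A (c * sin φ) * k φ
        = ∫ φ in (0:ℝ)..(2 * π), (A (c * sin φ) - A 0) * k φ := by
      have : ∫ φ in (0:ℝ)..(2 * π), A 0 * k φ = 0 := by
        rw [intervalIntegral.integral_const_mul, hk0, mul_zero]
      have e2 : ∀ φ, (A (c * sin φ) - A 0) * k φ = A (c * sin φ) * k φ - A 0 * k φ :=
        fun φ => by ring
      simp only [e2]
      rw [intervalIntegral.integral_sub, this, sub_zero]
      · apply Continuous.intervalIntegrable; fun_prop
      · apply Continuous.intervalIntegrable; fun_prop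
    rw [e]
    have := intervalIntegral.norm_integral_le_of_norm_le_const (a := 0) (b := 2 * π)
      (f := fun φ => (A (c * sin φ) - A 0) * k φ) (C := C * c ^ 2) (by
        intro x _
        have hs := abs_sin_le_one x
        have h1 : |c * sin x| ≤ |c| := by
          rw [abs_mul]; nlinarith [abs_nonneg c]
        have h2 := hq (c * sin x) (h1.trans hc)
        have h3 : (c * sin x) ^ 2 ≤ c ^ 2 := sq_le_sq.2 h1
        rw [norm_mul, norm_eq_abs, norm_eq_abs]
        calc |A (c * sin x) - A 0| * |k x| ≤ |A (c * sin x) - A 0| * 1 :=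
              mul_le_mul_of_nonneg_left (hk1 x) (abs_nonneg _)
          _ ≤ C * (c * sin x) ^ 2 := by rw [mul_one]; exact h2
          _ ≤ C * c ^ 2 := mul_le_mul_of_nonneg_left h3 hC)
    rwa [sub_zero, abs_of_pos two_pi_pos, norm_eq_abs] at this
  have gb := bd (fun φ => sin (3 * φ)) (by fun_prop) (fun x => abs_sin_le_one _) (by
    rw [intervalIntegral.integral_comp_mul_left (fun x => sin x) (by norm_num : (3:ℝ) ≠ 0)]
    rw [integral_sin]
    have : cos (3 * (2 * π)) = 1 := by
      have := cos_nat_mul_two_pi 3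
      exact_mod_cast this
    simp [this])
  have mb := bd (fun φ => sin φ * cos φ ^ 2) (by fun_prop) (fun x => by
    rw [abs_mul, abs_pow]
    exact mul_le_one₀ (abs_sin_le_one _) (by positivity)
      (pow_le_one₀ (abs_nonneg _) (abs_cos_le_one _))) (by
    have := intervalIntegral.integral_eq_sub_of_hasDerivAt (a := 0) (b := 2 * π)
      (f := fun x => - cos x ^ 3 / 3) (f' := fun x => sin x * cos x ^ 2) (fun x _ => by
        refine (((hasDerivAt_cos x).fun_pow 3).fun_neg.div_const 3).congr_deriv ?_
        push_cast; ring) (by apply Continuous.intervalIntegrable; fun_prop)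
    rw [this]; simp)
  -- derivative of m
  have mder : ∀ c ∈ Ioo (0:ℝ) 1, HasDerivAt m ((m c - g c) / c) c := by
    intro c hc
    have inU : ∀ c ∈ Ioo (-1:ℝ) 1, ∀ x, c * sin x ∈ Ioo (-1:ℝ) 1 := by
      intro c hc x
      rw [mem_Ioo, ← abs_lt] at hc
      rw [mem_Ioo, ← abs_lt, abs_mul]
      nlinarith [abs_sin_le_one x, abs_nonneg c, abs_nonneg (sin x)]
    have hcU : c ∈ Ioo (-1:ℝ) 1 := ⟨by linarith [hc.1], hc.2⟩
    have h := param_deriv (Ioo (-1:ℝ) 1) isOpen_Ioo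
      (fun c φ => A (c * sin φ) * (sin φ * cos φ ^ 2))
      (fun c φ => A' (c * sin φ) * sin φ * (sin φ * cos φ ^ 2))
      (fun s hs t => by
        have := (hd _ (inU s hs t)).comp s ((hasDerivAt_id s).mul_const (sin t))
        refine (this.mul_const (sin t * cos t ^ 2)).congr_deriv ?_
        ring)
      (by apply Continuous.continuousOn; fun_prop)
      (by
        have : ContinuousOn (fun p : ℝ × ℝ => A' (p.1 * sin p.2)) (Ioo (-1:ℝ) 1 ×ˢ univ) :=
          hA'.comp (f := fun p : ℝ × ℝ => p.1 * sin p.2) (by fun_prop)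
            (fun p hp => inU p.1 hp.1 p.2)
        exact (this.mul (by fun_prop)).mul (by fun_prop)) 0 (2 * π) c hcU
    convert h using 1
    rw [div_eq_iff hc.1.ne']
    have cA' : Continuous fun φ => A' (c * sin φ) := by
      rw [← continuousOn_univ]
      exact hA'.comp (f := fun t => c * sin t) (by fun_prop) (fun t _ => inU c hcU t)
    have key := intervalIntegral.integral_eq_sub_of_hasDerivAt (a := 0) (b := 2 * π)
      (f := fun x => A (c * sin x) * (sin x ^ 2 * cos x))
      (f' := fun x => A' (c * sin x) * (c * cos x) * (sin x ^ 2 * cos x)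
        + A (c * sin x) * (2 * sin x * cos x * cos x - sin x ^ 3)) (fun x _ => by
        have h1 := (hd _ (inU c hcU x)).comp x ((hasDerivAt_sin x).const_mul c)
        have h2 := ((hasDerivAt_sin x).fun_pow 2).fun_mul (hasDerivAt_cos x)
        refine (h1.fun_mul h2).congr_deriv ?_
        simp only [Function.comp]
        push_cast; ring) (by
          apply Continuous.intervalIntegrable
          exact ((cA'.mul (by fun_prop)).mul (by fun_prop)).add (by fun_prop))
    simp only [sin_two_pi, sin_zero] at key
    rw [hm, hg]
    simp only
    rw [← intervalIntegral.integral_mul_const, ← intervalIntegral.integral_sub]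
    · rw [← sub_eq_zero, ← intervalIntegral.integral_sub]
      · rw [← neg_eq_zero, ← intervalIntegral.integral_neg]
        norm_num at key
        rw [← key]
        congr 1; ext x
        rw [sin_three_mul]
        have : cos x ^ 2 = 1 - sin x ^ 2 := by rw [cos_sq']
        linear_combination (-3 * A (c * sin x) * sin x) * this
      · apply Continuous.intervalIntegrable; fun_prop
      · apply Continuous.intervalIntegrable
        exact ((cA'.mul (by fun_prop)).mul (by fun_prop)).mul (by fun_prop)
    · apply Continuous.intervalIntegrable; fun_prop
    · apply Continuous.intervalIntegrable; fun_prop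
  have hpi := pi_pos
  have m1 : (∫ φ in (0:ℝ)..(2 * π), A (sin φ) * (sin φ * cos φ ^ 2)) = m 1 := by simp [hm]
  rw [m1, ← zero_sub]
  have cpos : ∀ x ∈ Ioo 0 (π / 2), cos x ∈ Ioo (0:ℝ) 1 := by
    intro x hx
    refine ⟨cos_pos_of_mem_Ioo ⟨by linarith [hx.1], hx.2⟩, ?_⟩
    rw [← cos_zero]
    exact cos_lt_cos_of_nonneg_of_le_pi_div_two le_rfl hx.2.le hx.1
  have tc : Tendsto cos (𝓝[<] (π / 2)) (𝓝 0) := by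
    have := (continuous_cos.tendsto (π / 2)).mono_left (nhdsWithin_le_nhds (s := Iio (π / 2)))
    simpa using this
  have hev : ∀ᶠ x in 𝓝[<] (π / 2), x ∈ Ioo 0 (π / 2) := Ioo_mem_nhdsLT (by positivity)
  apply intervalIntegral.integral_eq_sub_of_hasDerivAt_of_tendsto (f := fun x => m (cos x) / cos x)
    (by positivity)
  · intro x hx
    have hc := cpos x hx
    have h := ((mder _ hc).comp x (hasDerivAt_cos x)).div (hasDerivAt_cos x) hc.1.ne'
    refine h.congr_deriv ?_
    have := hc.1.ne'
    simp only [Function.comp]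
    change _ = sin x / cos x ^ 2 * g (cos x)
    field_simp
    ring
  · -- integrability
    rw [intervalIntegrable_iff_integrableOn_Ioo_of_le (by positivity)]
    obtain ⟨D, hD⟩ := isCompact_Icc.exists_bound_of_continuousOn
      (gcont.continuousOn (s := Icc (-1) 1))
    have hmeas : AEStronglyMeasurable (fun ν => sin ν / cos ν ^ 2 * g (cos ν)) volume := by
      have : Measurable (fun ν => sin ν / cos ν ^ 2 * g (cos ν)) := by
        have := gcont.measurable
        fun_prop
      exact this.aestronglyMeasurable
    refine Measure.integrableOn_of_bounded (M := C * (2 * π) + D / δ ^ 2) (by simp) hmeas ?_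
    rw [ae_restrict_iff' measurableSet_Ioo]
    refine Eventually.of_forall fun x hx => ?_
    have hc := cpos x hx
    have hD1 := hD (cos x) ⟨by linarith [hc.1], hc.2.le⟩
    have hD0 := (norm_nonneg _).trans hD1
    have hc2 : 0 < cos x ^ 2 := pow_pos hc.1 2
    rw [norm_mul, norm_div, norm_eq_abs, norm_eq_abs, abs_of_pos hc2]
    have hb : ‖g (cos x)‖ ≤ (C * (2 * π) + D / δ ^ 2) * cos x ^ 2 := by
      rcases le_total (cos x) δ with h | h
      · have := gb (cos x) (by rwa [abs_of_pos hc.1])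
        have h0 : 0 ≤ D / δ ^ 2 * cos x ^ 2 := by positivity
        rw [norm_eq_abs]
        simp only [hg]
        linarith
      · have h0 : 0 ≤ C * (2 * π) * cos x ^ 2 := by positivity
        have : D ≤ D / δ ^ 2 * cos x ^ 2 := by
          rw [div_mul_eq_mul_div, le_div_iff₀ (by positivity)]
          exact mul_le_mul_of_nonneg_left (pow_le_pow_left₀ hδ.le h 2) hD0
        linarith
    rw [div_mul_eq_mul_div, div_le_iff₀ hc2]
    refine le_trans ?_ hb
    exact mul_le_of_le_one_left (norm_nonneg _) (abs_sin_le_one x)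
  · have : ContinuousAt (fun x => m (cos x) / cos x) 0 := by
      apply ContinuousAt.div <;> first | fun_prop | simp
    have := this.tendsto.mono_left (nhdsWithin_le_nhds (s := Ioi 0))
    simpa using this
  · apply squeeze_zero_norm' (a := fun x => C * cos x * (2 * π))
    · have : ∀ᶠ x in 𝓝[<] (π / 2), cos x < δ := tc.eventually_lt_const hδ
      filter_upwards [this, hev] with x h hx
      have hc := cpos x hx
      rw [norm_div, norm_eq_abs, norm_eq_abs, abs_of_pos hc.1, div_le_iff₀ hc.1]
      have := mb (cos x) (by rw [abs_of_pos hc.1]; exact h.le)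
      simp only [hm]
      linarith
    · have := (tc.const_mul C).mul_const (2 * π)
      simpa using this

lemma quad_bound (A A' : ℝ → ℝ) (hd : ∀ s ∈ Ioo (-1:ℝ) 1, HasDerivAt A (A' s) s)
    (h0 : A' 0 = 0) (hdd : DifferentiableAt ℝ A' 0) :
    ∃ C, ∃ δ > 0, ∀ s, |s| ≤ δ → |A s - A 0| ≤ C * s ^ 2 := by
  have hO := hdd.hasDerivAt.isBigO_sub
  obtain ⟨C, hC⟩ := hO.bound
  obtain ⟨ε, hε, hb⟩ := Metric.eventually_nhds_iff.1 hC
  refine ⟨C, min (ε / 2) (1 / 2), by positivity, fun s hs => ?_⟩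
  have hs1 : |s| < ε := by linarith [min_le_left (ε / 2) (1 / 2 : ℝ)]
  have hs2 : |s| < 1 := by linarith [min_le_right (ε / 2) (1 / 2 : ℝ)]
  have hx : ∀ x ∈ Icc (-|s|) |s|, |x| ≤ |s| := fun x hx => abs_le.2 hx
  have key := (convex_Icc (-|s|) |s|).norm_image_sub_le_of_norm_hasDerivWithin_le
    (f := A) (f' := A') (C := C * |s|) (x := 0) (y := s)
    (fun x hx' => (hd x (abs_lt.1 ((hx x hx').trans_lt hs2))).hasDerivWithinAt)
    (fun x hx' => by
      have h1 := hb (y := x) (by rw [dist_zero_right, norm_eq_abs]; exact (hx x hx').trans_lt hs1)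
      simp only [h0, sub_zero, norm_eq_abs] at h1
      rw [norm_eq_abs]
      have hCx : 0 ≤ C * |s| := by
        rcases eq_or_ne s 0 with rfl | hne
        · simp
        · have h2 := hb (y := s) (by rw [dist_zero_right, norm_eq_abs]; exact hs1)
          simp only [h0, sub_zero, norm_eq_abs] at h2
          exact (abs_nonneg _).trans h2
      have hC0 : 0 ≤ C ∨ s = 0 := by
        by_contra! h
        have := abs_pos.2 h.2
        nlinarith
      rcases hC0 with h | h
      · exact h1.trans (mul_le_mul_of_nonneg_left (hx x hx') h)
      · have : x = 0 := by
          have := hx x hx'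
          rw [h, abs_zero] at this
          exact abs_eq_zero.1 (le_antisymm this (abs_nonneg _))
        simp [this, h0, h])
    (by simp) (abs_le.1 le_rfl)
  rw [norm_eq_abs, sub_zero, norm_eq_abs] at key
  calc _ ≤ _ := key
    _ = C * s ^ 2 := by rw [mul_assoc, ← sq, sq_abs]

lemma half_to_full (A : ℝ → ℝ) (hA : Continuous A) :
    ∫ φ in (0:ℝ)..(2 * π), A (sin φ) * (sin φ * cos φ ^ 2) =
      2 * ∫ φ in (-(π / 2))..(π / 2), A (sin φ) * (sin φ * cos φ ^ 2) := by
  set k : ℝ → ℝ := fun φ => A (sin φ) * (sin φ * cos φ ^ 2) with hk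
  have kc : Continuous k := by fun_prop
  have hp : Function.Periodic k (2 * π) := by intro x; simp [hk]
  have h1 := hp.intervalIntegral_add_eq 0 (-(π / 2))
  rw [zero_add] at h1
  rw [h1, ← intervalIntegral.integral_add_adjacent_intervals (b := π / 2)
    (kc.intervalIntegrable _ _) (kc.intervalIntegrable _ _)]
  have h2 : ∫ x in (π / 2)..(-(π / 2) + 2 * π), k x = ∫ x in (-(π / 2))..(π / 2), k x := by
    have := intervalIntegral.integral_comp_sub_left (a := -(π / 2)) (b := π / 2) k π
    have e : ∀ x, k (π - x) = k x := by intro x; simp [hk, sin_pi_sub, cos_pi_sub]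
    simp only [e] at this
    rw [this]
    congr 1 <;> ring
  rw [h2]; ring

lemma nz {e₁ e₂ Ω : EuclideanSpace ℝ (Fin 3)}
    (hΩ : ‖Ω‖ = 1) (he₁ : ‖e₁‖ = 1) (he₂ : ‖e₂‖ = 1)
    (h₁₂ : ⟪e₁, e₂⟫ = 0) (h₁Ω : ⟪e₁, Ω⟫ = 0) (h₂Ω : ⟪e₂, Ω⟫ = 0) (x y z : ℝ)
    (h : x ^ 2 + y ^ 2 + z ^ 2 ≠ 0) : x • e₁ + y • e₂ + z • Ω ≠ 0 := by
  intro h0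
  apply h
  have hh : ⟪x • e₁ + y • e₂ + z • Ω, x • e₁ + y • e₂ + z • Ω⟫ = x ^ 2 + y ^ 2 + z ^ 2 := by
    simp only [inner_add_left, inner_add_right, real_inner_smul_left, real_inner_smul_right,
      real_inner_self_eq_norm_sq, norm_smul, hΩ, he₁, he₂, h₁₂, h₁Ω, h₂Ω,
      real_inner_comm e₁ e₂, real_inner_comm e₁ Ω, real_inner_comm e₂ Ω, norm_eq_abs,
      mul_one, sq_abs]
    ring
  rw [← hh, h0, inner_zero_left]

theorem support_function_representation_via_projection_curvature
    (B : Set (EuclideanSpace ℝ (Fin 3)))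
    (hBconv : Convex ℝ B) (hBcomp : IsCompact B) (hBint : (interior B).Nonempty)
    (H : EuclideanSpace ℝ (Fin 3) → ℝ)
    (hH : ∀ x : EuclideanSpace ℝ (Fin 3), H x = sSup ((fun y => ⟪x, y⟫) '' B))
    (hsmooth : ContDiffOn ℝ 3 H {(0 : EuclideanSpace ℝ (Fin 3))}ᶜ)
    (hcentroid : ∀ Ω' e₁' e₂' : EuclideanSpace ℝ (Fin 3),
      ‖Ω'‖ = 1 → ‖e₁'‖ = 1 → ‖e₂'‖ = 1 →
      ⟪e₁', e₂'⟫ = 0 → ⟪e₁', Ω'⟫ = 0 → ⟪e₂', Ω'⟫ = 0 →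
      ∫ τ in (0:ℝ)..(2 * Real.pi),
        ⟪gradient H (Real.cos τ • e₁' + Real.sin τ • e₂'), Ω'⟫ = 0)
    (Ω e₁ e₂ : EuclideanSpace ℝ (Fin 3))
    (hΩ : ‖Ω‖ = 1) (he₁ : ‖e₁‖ = 1) (he₂ : ‖e₂‖ = 1)
    (h₁₂ : ⟪e₁, e₂⟫ = 0) (h₁Ω : ⟪e₁, Ω⟫ = 0) (h₂Ω : ⟪e₂, Ω⟫ = 0)
    (u E : ℝ → EuclideanSpace ℝ (Fin 3)) (N : ℝ → ℝ → EuclideanSpace ℝ (Fin 3))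
    (hu : ∀ τ : ℝ, u τ = Real.cos τ • e₁ + Real.sin τ • e₂)
    (hE : ∀ τ : ℝ, E τ = (-Real.sin τ) • e₁ + Real.cos τ • e₂)
    (hN : ∀ ν τ : ℝ, N ν τ = (-Real.sin ν) • u τ + Real.cos ν • Ω)
    (R : ℝ → ℝ → ℝ → ℝ)
    (hR : ∀ ν τ φ : ℝ, R ν τ φ =
      (fun ψ : ℝ => H (Real.cos ψ • E τ + Real.sin ψ • N ν τ)) φ +
        deriv (deriv (fun ψ : ℝ => H (Real.cos ψ • E τ + Real.sin ψ • N ν τ))) φ) :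
    H Ω =
      (1 / (4 * Real.pi)) *
        (∫ τ in (0:ℝ)..(2 * Real.pi), ∫ φ in (0:ℝ)..(Real.pi / 2),
          R 0 τ φ * Real.cos φ) +
      (1 / (8 * Real.pi ^ 2)) *
        (∫ τ in (0:ℝ)..(2 * Real.pi), ∫ φ in (-(Real.pi / 2))..(Real.pi / 2),
          R 0 τ φ * ((Real.pi + 2 * φ) * Real.cos φ - 2 * Real.sin φ ^ 3)) -
      (1 / (2 * Real.pi ^ 2)) *
        (∫ ν in (0:ℝ)..(Real.pi / 2), (Real.sin ν / Real.cos ν ^ 2) *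
          (∫ τ in (0:ℝ)..(2 * Real.pi), ∫ φ in (0:ℝ)..(2 * Real.pi),
            R ν τ φ * Real.sin φ ^ 3)) := by
  have NZ := nz hΩ he₁ he₂ h₁₂ h₁Ω h₂Ω
  have hO : IsOpen ({(0 : EuclideanSpace ℝ (Fin 3))}ᶜ) := isOpen_compl_singleton
  -- nonvanishing of the relevant vectors
  have nzr : ∀ r s τ : ℝ, r ^ 2 + s ^ 2 ≠ 0 → r • E τ + s • Ω ≠ 0 := by
    intro r s τ h
    have := NZ (-(r * sin τ)) (r * cos τ) s (by
      have : (-(r * sin τ)) ^ 2 + (r * cos τ) ^ 2 + s ^ 2 = r ^ 2 + s ^ 2 := by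
        linear_combination r ^ 2 * sin_sq_add_cos_sq τ
      rwa [this])
    convert this using 1
    rw [hE]; module
  have nzP : ∀ ν τ φ : ℝ, cos φ • E τ + sin φ • N ν τ ≠ 0 := by
    intro ν τ φ
    have := NZ (-(cos φ * sin τ) - sin φ * sin ν * cos τ)
      (cos φ * cos τ - sin φ * sin ν * sin τ) (sin φ * cos ν) (by
      have : (-(cos φ * sin τ) - sin φ * sin ν * cos τ) ^ 2 +
        (cos φ * cos τ - sin φ * sin ν * sin τ) ^ 2 + (sin φ * cos ν) ^ 2 = 1 := by
        linear_combination (cos φ ^ 2 + sin φ ^ 2 * sin ν ^ 2) * sin_sq_add_cos_sq τ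
          + sin φ ^ 2 * sin_sq_add_cos_sq ν + sin_sq_add_cos_sq φ
      rw [this]; norm_num)
    convert this using 1
    rw [hN, hu, hE]; module
  have hN0 : ∀ τ, N 0 τ = Ω := by intro τ; rw [hN]; simp
  have hEc : ContDiff ℝ 3 E := by
    have : E = fun τ => (-Real.sin τ) • e₁ + Real.cos τ • e₂ := funext hE
    rw [this]
    have := contDiff_sin (n := 3)
    have := contDiff_cos (n := 3)
    fun_prop
  have huc : Continuous u := by
    have : u = fun τ => cos τ • e₁ + sin τ • e₂ := funext hu
    rw [this]; fun_prop
  have hNc : Continuous (fun p : ℝ × ℝ => N p.1 p.2) := by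
    have : (fun p : ℝ × ℝ => N p.1 p.2) = fun p => (-sin p.1) • u p.2 + cos p.1 • Ω :=
      funext fun p => hN _ _
    rw [this]; fun_prop
  have hEcont : Continuous E := hEc.continuous
  have Hcont : ∀ {α : Type} [TopologicalSpace α] (v : α → EuclideanSpace ℝ (Fin 3)),
      Continuous v → (∀ x, v x ≠ 0) → Continuous fun x => H (v x) := by
    intro α _ v hv hv0
    rw [← continuousOn_univ]
    exact hsmooth.continuousOn.comp (f := v) hv.continuousOn (fun x _ => hv0 x)
  have Hfd : ∀ x, x ≠ 0 → HasFDerivAt H (fderiv ℝ H x) x := by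
    intro x hx
    exact ((hsmooth.differentiableOn (by simp)).differentiableAt (hO.mem_nhds hx)).hasFDerivAt
  have Hfdc : ContinuousOn (fderiv ℝ H) ({(0 : EuclideanSpace ℝ (Fin 3))}ᶜ) :=
    hsmooth.continuousOn_fderiv_of_isOpen hO (by norm_num)
  -- the circle functions
  have fC : ∀ ν τ : ℝ, ContDiff ℝ 2 (fun ψ : ℝ => H (cos ψ • E τ + sin ψ • N ν τ)) := by
    intro ν τ
    rw [← contDiffOn_univ]
    have h1 : ContDiff ℝ 2 (fun ψ : ℝ => cos ψ • E τ + sin ψ • N ν τ) := by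
      have := contDiff_sin (n := 2)
      have := contDiff_cos (n := 2)
      fun_prop
    exact (hsmooth.of_le (by norm_num)).comp h1.contDiffOn (fun x _ => nzP ν τ x)
  have fD : ∀ ν τ φ : ℝ, deriv (fun ψ : ℝ => H (cos ψ • E τ + sin ψ • N ν τ)) φ =
      fderiv ℝ H (cos φ • E τ + sin φ • N ν τ) ((-sin φ) • E τ + cos φ • N ν τ) := by
    intro ν τ φ
    have h1 : HasDerivAt (fun ψ : ℝ => cos ψ • E τ + sin ψ • N ν τ)
        ((-sin φ) • E τ + cos φ • N ν τ) φ :=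
      ((hasDerivAt_cos φ).smul_const _).add ((hasDerivAt_sin φ).smul_const _)
    exact ((Hfd _ (nzP ν τ φ)).comp_hasDerivAt φ h1).deriv
  -- joint continuity
  have Pc : ∀ ν, Continuous (fun p : ℝ × ℝ => H (cos p.2 • E p.1 + sin p.2 • N ν p.1)) := by
    intro ν
    refine Hcont _ ?_ (fun p => nzP ν p.1 p.2)
    have : Continuous (fun p : ℝ × ℝ => N ν p.1) :=
      hNc.comp (f := fun p : ℝ × ℝ => (ν, p.1)) (by fun_prop)
    fun_prop
  -- centroid condition
  have cen : ∫ τ in (0:ℝ)..(2 * π), fderiv ℝ H (E τ) Ω = 0 := by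
    have := hcentroid Ω e₂ (-e₁) hΩ he₂ (by rw [norm_neg]; exact he₁)
      (by rw [inner_neg_right, real_inner_comm, h₁₂, neg_zero]) h₂Ω
      (by rw [inner_neg_left, h₁Ω, neg_zero])
    rw [← this]
    congr 1; ext τ
    have e : cos τ • e₂ + sin τ • (-e₁) = E τ := by rw [hE]; module
    rw [e, gradient, InnerProductSpace.toDual_symm_apply]
  have linE : ∀ L : EuclideanSpace ℝ (Fin 3) →L[ℝ] ℝ, ∫ τ in (0:ℝ)..(2 * π), L (E τ) = 0 := by
    intro L
    have : ∀ τ, L (E τ) = (- sin τ) * L e₁ + cos τ * L e₂ := by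
      intro τ; rw [hE]; simp
    simp only [this]
    rw [intervalIntegral.integral_add, intervalIntegral.integral_mul_const,
      intervalIntegral.integral_mul_const, intervalIntegral.integral_neg, integral_sin,
      integral_cos]
    · simp
    · apply Continuous.intervalIntegrable; fun_prop
    · apply Continuous.intervalIntegrable; fun_prop
  -- the zonal average
  set A : ℝ → ℝ := fun s => ∫ τ in (0:ℝ)..(2 * π), H (√(1 - s ^ 2) • E τ + s • Ω) with hAdef
  have sq_ne : ∀ s : ℝ, √(1 - s ^ 2) ^ 2 + s ^ 2 ≠ 0 := by
    intro s h
    have h1 : s = 0 := by nlinarith [sq_nonneg (√(1 - s ^ 2)), sq_nonneg s]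
    rw [h1] at h; norm_num at h
  have hAc : Continuous A := by
    apply intervalIntegral.continuous_parametric_intervalIntegral_of_continuous'
    exact Hcont (fun p : ℝ × ℝ => √(1 - p.1 ^ 2) • E p.2 + p.1 • Ω) (by fun_prop)
      (fun p => nzr _ _ _ (sq_ne _))
  have rot : ∀ ν φ : ℝ, ∫ τ in (0:ℝ)..(2 * π), H (cos φ • E τ + sin φ • N ν τ)
      = A (cos ν * sin φ) := by
    intro ν φ
    set s := cos ν * sin φ with hs
    set r := √(1 - s ^ 2) with hr
    have hr2 : cos φ ^ 2 + (sin φ * sin ν) ^ 2 = 1 - s ^ 2 := by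
      rw [hs]; linear_combination sin φ ^ 2 * sin_sq_add_cos_sq ν + sin_sq_add_cos_sq φ
    obtain ⟨δ, hδ1, hδ2⟩ : ∃ δ : ℝ, cos φ = r * cos δ ∧ sin φ * sin ν = r * sin δ := by
      set z : ℂ := ⟨cos φ, sin φ * sin ν⟩ with hz
      have hn : ‖z‖ = r := by
        rw [Complex.norm_eq_sqrt_sq_add_sq, hr, ← hr2]
      refine ⟨z.arg, ?_, ?_⟩
      · rw [← hn, Complex.norm_mul_cos_arg]
      · rw [← hn, Complex.norm_mul_sin_arg]
    have e : ∀ τ, cos φ • E τ + sin φ • N ν τ = r • E (τ + δ) + s • Ω := by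
      intro τ
      have e1 : cos φ • E τ + sin φ • N ν τ = cos φ • E τ - (sin φ * sin ν) • u τ + s • Ω := by
        rw [hN, hs]; module
      rw [e1, hδ1, hδ2, hE (τ + δ), sin_add, cos_add, hE, hu]; module
    simp only [e]
    rw [intervalIntegral.integral_comp_add_right (fun τ => H (r • E τ + s • Ω)) δ]
    have hp : Function.Periodic (fun τ => H (r • E τ + s • Ω)) (2 * π) := by
      intro τ; simp [hE]
    have := hp.intervalIntegral_add_eq δ 0
    rw [zero_add] at this
    rw [zero_add, add_comm (2 * π) δ]
    exact this
  -- smoothness of A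
  set K : ℝ × ℝ → ℝ := fun p => H (√(1 - p.1 ^ 2) • E p.2 + p.1 • Ω) with hKdef
  have hKs : ContDiffOn ℝ 2 K (Ioo (-1:ℝ) 1 ×ˢ univ) := by
    have hv : ContDiffOn ℝ 2 (fun p : ℝ × ℝ => √(1 - p.1 ^ 2) • E p.2 + p.1 • Ω)
        (Ioo (-1:ℝ) 1 ×ˢ univ) := by
      have h1 : ContDiffOn ℝ 2 (fun p : ℝ × ℝ => √(1 - p.1 ^ 2)) (Ioo (-1:ℝ) 1 ×ˢ univ) := by
        apply ContDiffOn.sqrt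
        · fun_prop
        · rintro ⟨s, t⟩ ⟨hs, -⟩
          simp only [mem_Ioo] at hs ⊢
          nlinarith [hs.1, hs.2]
      have h2 : ContDiff ℝ 2 (fun p : ℝ × ℝ => E p.2) :=
        (hEc.of_le (by norm_num)).comp contDiff_snd
      have h3 : ContDiff ℝ 2 (fun p : ℝ × ℝ => p.1 • Ω) := by fun_prop
      exact (h1.smul h2.contDiffOn).add h3.contDiffOn
    exact (hsmooth.of_le (by norm_num)).comp hv (fun p _ => nzr _ _ _ (sq_ne _))
  obtain ⟨k1, k2, k3⟩ := param_deriv_contDiff 1 (Ioo (-1:ℝ) 1) isOpen_Ioo K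
    (by norm_num; exact hKs) 0 (2 * π)
  obtain ⟨-, -, k4⟩ := param_deriv_contDiff 0 (Ioo (-1:ℝ) 1) isOpen_Ioo
    (fun p => fderiv ℝ K p (1, 0)) (by norm_num at k1 ⊢; exact k1) 0 (2 * π)
  set A' : ℝ → ℝ := fun s => ∫ t in (0:ℝ)..(2 * π), fderiv ℝ K (s, t) (1, 0) with hA'
  have hd : ∀ s ∈ Ioo (-1:ℝ) 1, HasDerivAt A (A' s) s := k3
  have hA'c : ContinuousOn A' (Ioo (-1:ℝ) 1) := fun s hs =>
    (k4 s hs).continuousAt.continuousWithinAt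
  have h0mem : (0:ℝ) ∈ Ioo (-1:ℝ) 1 := by simp
  have hA'0 : A' 0 = 0 := by
    refine Eq.trans ?_ cen
    change ∫ t in (0:ℝ)..(2 * π), fderiv ℝ K (0, t) (1, 0) = _
    congr 1; ext t
    refine (k2 0 h0mem t).unique ?_
    have h1 : HasDerivAt (fun s : ℝ => √(1 - s ^ 2)) 0 0 := by
      have := (((hasDerivAt_id (0:ℝ)).fun_pow 2).const_sub 1).sqrt (by norm_num)
      simpa using this
    have h2 : HasDerivAt (fun s : ℝ => √(1 - s ^ 2) • E t + s • Ω) Ω 0 := by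
      have := (h1.smul_const (E t)).fun_add ((hasDerivAt_id (0:ℝ)).smul_const Ω)
      simpa using this
    have h3 := (Hfd _ (nzr _ _ t (sq_ne 0))).comp_hasDerivAt (0:ℝ) h2
    have e : √(1 - (0:ℝ) ^ 2) • E t + (0:ℝ) • Ω = E t := by simp
    rw [e] at h3
    exact h3
  have hq := quad_bound A A' hd hA'0 (k4 0 h0mem).differentiableAt
  have hcore := core A A' hAc hd hA'c hq
  have T3 : ∀ ν, (∫ τ in (0:ℝ)..(2 * π), ∫ φ in (0:ℝ)..(2 * π), R ν τ φ * sin φ ^ 3)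
      = 2 * ∫ φ in (0:ℝ)..(2 * π), A (cos ν * sin φ) * sin (3 * φ) := by
    intro ν
    have h1 : ∀ τ, ∫ φ in (0:ℝ)..(2 * π), R ν τ φ * sin φ ^ 3 =
        ∫ φ in (0:ℝ)..(2 * π), H (cos φ • E τ + sin φ • N ν τ) * (2 * sin (3 * φ)) := by
      intro τ
      simp only [hR]
      rw [parts2 _ (fun φ => sin φ ^ 3) (fun φ => 3 * sin φ ^ 2 * cos φ)
        (fun φ => 6 * sin φ * cos φ ^ 2 - 3 * sin φ ^ 3) (fC ν τ)
        (fun x => by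
          refine ((hasDerivAt_sin x).fun_pow 3).congr_deriv ?_
          push_cast; ring)
        (fun x => by
          refine ((((hasDerivAt_sin x).fun_pow 2).const_mul 3).fun_mul
            (hasDerivAt_cos x)).congr_deriv ?_
          push_cast; ring) (by fun_prop)]
      simp only [sin_two_pi, sin_zero]
      norm_num
      congr 1; ext x
      rw [sin_three_mul, cos_sq']; ring
    simp only [h1]
    rw [swapc (fun τ φ => H (cos φ • E τ + sin φ • N ν τ) * (2 * sin (3 * φ)))
      ((Pc ν).mul (by fun_prop)), ← intervalIntegral.integral_const_mul]
    congr 1; ext φ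
    rw [intervalIntegral.integral_mul_const, rot]; ring
  -- first term
  have cE : Continuous fun τ => fderiv ℝ H (E τ) Ω := by
    have : Continuous fun τ => fderiv ℝ H (E τ) := by
      rw [← continuousOn_univ]
      refine Hfdc.comp (f := E) hEcont.continuousOn (fun τ _ => ?_)
      have := nzr 1 0 τ (by norm_num)
      simpa using this
    fun_prop
  have T1 : (∫ τ in (0:ℝ)..(2 * π), ∫ φ in (0:ℝ)..(π / 2), R 0 τ φ * cos φ)
      = 2 * π * H Ω := by
    have h1 : ∀ τ, ∫ φ in (0:ℝ)..(π / 2), R 0 τ φ * cos φ = H Ω - fderiv ℝ H (E τ) Ω := by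
      intro τ
      simp only [hR]
      rw [parts2 _ (fun φ => cos φ) (fun φ => - sin φ)
        (fun φ => - cos φ) (fC 0 τ) (fun x => hasDerivAt_cos x)
        (fun x => (hasDerivAt_sin x).fun_neg) (by fun_prop), fD, fD, hN0]
      simp
    simp only [h1]
    rw [intervalIntegral.integral_sub (by simp) (cE.intervalIntegrable _ _), cen]
    simp
  -- second term
  have T2 : (∫ τ in (0:ℝ)..(2 * π), ∫ φ in (-(π / 2))..(π / 2),
      R 0 τ φ * ((π + 2 * φ) * cos φ - 2 * sin φ ^ 3))
      = 4 * π ^ 2 * H Ω - 16 * ∫ φ in (-(π / 2))..(π / 2), A (sin φ) * (sin φ * cos φ ^ 2) := by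
    have h1 : ∀ τ, ∫ φ in (-(π / 2))..(π / 2),
        R 0 τ φ * ((π + 2 * φ) * cos φ - 2 * sin φ ^ 3) =
        (2 * π * H Ω + ((2 : ℝ) • fderiv ℝ H Ω - (2 : ℝ) • fderiv ℝ H (-Ω)) (E τ)) +
        ∫ φ in (-(π / 2))..(π / 2), H (cos φ • E τ + sin φ • N 0 τ) *
          (-16 * (sin φ * cos φ ^ 2)) := by
      intro τ
      simp only [hR]
      rw [parts2 _ (fun φ => (π + 2 * φ) * cos φ - 2 * sin φ ^ 3)
        (fun φ => 2 * cos φ - (π + 2 * φ) * sin φ - 6 * sin φ ^ 2 * cos φ)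
        (fun φ => - 4 * sin φ - (π + 2 * φ) * cos φ - 12 * sin φ * cos φ ^ 2 + 6 * sin φ ^ 3)
        (fC 0 τ)
        (fun x => by
          refine (((((hasDerivAt_id x).const_mul 2).const_add π).fun_mul
            (hasDerivAt_cos x)).fun_sub
            (((hasDerivAt_sin x).fun_pow 3).const_mul 2)).congr_deriv ?_
          simp only [id]; push_cast; ring)
        (fun x => by
          refine ((((hasDerivAt_cos x).const_mul 2).fun_sub
            ((((hasDerivAt_id x).const_mul 2).const_add π).fun_mul (hasDerivAt_sin x))).fun_sub
            ((((hasDerivAt_sin x).fun_pow 2).const_mul 6).fun_mul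
              (hasDerivAt_cos x))).congr_deriv ?_
          simp only [id]; push_cast; ring) (by fun_prop), fD, fD, hN0]
      congr 1
      · simp only [cos_neg, sin_neg, cos_pi_div_two, sin_pi_div_two]
        simp
        ring
      · congr 1; ext x
        have : sin x ^ 3 = sin x * (1 - cos x ^ 2) := by rw [← sin_sq]; ring
        rw [this]; ring
    simp only [h1]
    have hPc := Pc 0
    have hcc : Continuous (fun p : ℝ × ℝ => H (cos p.2 • E p.1 + sin p.2 • N 0 p.1) *
          (-16 * (sin p.2 * cos p.2 ^ 2))) := hPc.mul (by fun_prop)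
    have hc1 : Continuous fun τ => ((2 : ℝ) • fderiv ℝ H Ω - (2 : ℝ) • fderiv ℝ H (-Ω)) (E τ) := by
      fun_prop
    rw [intervalIntegral.integral_add
      (Continuous.intervalIntegrable (by fun_prop) _ _)
      ((intervalIntegral.continuous_parametric_intervalIntegral_of_continuous'
        (f := fun τ φ => H (cos φ • E τ + sin φ • N 0 τ) * (-16 * (sin φ * cos φ ^ 2)))
        hcc _ _).intervalIntegrable _ _),
      intervalIntegral.integral_add (by simp) (hc1.intervalIntegrable _ _), linE,
      swapc (fun τ φ => H (cos φ • E τ + sin φ • N 0 τ) * (-16 * (sin φ * cos φ ^ 2))) hcc]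
    have e : ∀ φ, ∫ τ in (0:ℝ)..(2 * π), H (cos φ • E τ + sin φ • N 0 τ) *
        (-16 * (sin φ * cos φ ^ 2)) = -16 * (A (sin φ) * (sin φ * cos φ ^ 2)) := by
      intro φ
      rw [intervalIntegral.integral_mul_const, rot, cos_zero, one_mul]; ring
    simp only [e]
    rw [intervalIntegral.integral_const, intervalIntegral.integral_const_mul, smul_eq_mul]
    ring
  simp only [T3]
  rw [T1, T2]
  have e3 : ∫ ν in (0:ℝ)..(π / 2), sin ν / cos ν ^ 2 *
      (2 * ∫ φ in (0:ℝ)..(2 * π), A (cos ν * sin φ) * sin (3 * φ)) =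
      2 * (- ∫ φ in (0:ℝ)..(2 * π), A (sin φ) * (sin φ * cos φ ^ 2)) := by
    rw [← hcore, ← intervalIntegral.integral_const_mul]
    congr 1; ext ν; ring
  rw [e3, half_to_full A hAc]
  have := pi_ne_zero
  field_simp
  ring
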